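/- Hulls correspond to associates: Let ⊗_α be a tensor product of 0-symmetric convex bodies of order l, with associated tensor norm ‖·‖_{⊗_α}. Then the tensor norm associated to ⊗_{α^{inj}} is the injective associate of ‖·‖_{⊗_α}, i.e. the biggest injective tensor norm β with β ≤ ‖·‖_{⊗_α}, and the tensor norm associated to ⊗_{α^{proj}} is the projective associate of ‖·‖_{⊗_α}, i.e. the smallest projective tensor norm β with β ≥ ‖·‖_{⊗_α}. -/

import Mathlib

open scoped TensorProduct RealInnerProductSpace Pointwise
open PiTensorProduct

noncomputable section

variable {l : ℕ}

/-- The Hilbert tensor inner product on `⨂[ℝ] i, E i`, determined on decomposable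
tensors by `⟪⨂ₜ x i, ⨂ₜ y i⟫_H = ∏ i, ⟪x i, y i⟫`. -/
def tensorInner (E : Fin l → Type) [∀ i, NormedAddCommGroup (E i)]
    [∀ i, InnerProductSpace ℝ (E i)] :
    (⨂[ℝ] i, E i) →ₗ[ℝ] (⨂[ℝ] i, E i) →ₗ[ℝ] ℝ :=
  (PiTensorProduct.map₂ (fun i => innerₗ (E i))).compr₂
    (PiTensorProduct.lift (MultilinearMap.mkPiAlgebra ℝ (Fin l) ℝ))

/-- The polar of a set with respect to a bilinear pairing `B`:
`C° = {z | ∀ u ∈ C, B u z ≤ 1}`. -/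
def polarB {V : Type*} [AddCommGroup V] [Module ℝ V]
    (B : V →ₗ[ℝ] V →ₗ[ℝ] ℝ) (C : Set V) : Set V :=
  {z | ∀ u ∈ C, B u z ≤ 1}

/-- The projective tensor product of sets:
`P₁ ⊗_π ⋯ ⊗_π P_l = conv {x¹ ⊗ ⋯ ⊗ x^l : xⁱ ∈ P i}`. -/
def projTP (E : Fin l → Type) [∀ i, NormedAddCommGroup (E i)]
    [∀ i, InnerProductSpace ℝ (E i)] (P : ∀ i, Set (E i)) : Set (⨂[ℝ] i, E i) :=
  convexHull ℝ {u | ∃ x : ∀ i, E i, (∀ i, x i ∈ P i) ∧ u = ⨂ₜ[ℝ] i, x i}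

/-- The injective tensor product of sets:
`P₁ ⊗_ε ⋯ ⊗_ε P_l = (P₁° ⊗_π ⋯ ⊗_π P_l°)°`, polars taken with respect to the
Hilbert tensor inner product. -/
def injTP (E : Fin l → Type) [∀ i, NormedAddCommGroup (E i)]
    [∀ i, InnerProductSpace ℝ (E i)] (P : ∀ i, Set (E i)) : Set (⨂[ℝ] i, E i) :=
  polarB (tensorInner E) (projTP E (fun i => polarB (innerₗ (E i)) (P i)))

/-- The canonical topology on the (finite-dimensional) tensor product space, defined
instance-free as the weak topology induced by all linear functionals; for
finite-dimensional real vector spaces this is the canonical (Euclidean) topology. -/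
instance tensorTopology (E : Fin l → Type) [∀ i, NormedAddCommGroup (E i)]
    [∀ i, InnerProductSpace ℝ (E i)] : TopologicalSpace (⨂[ℝ] i, E i) :=
  ⨅ (f : (⨂[ℝ] i, E i) →ₗ[ℝ] ℝ), TopologicalSpace.induced f inferInstance

/-- A convex body: a compact convex set with nonempty interior. -/
def IsConvexBody {V : Type*} [AddCommGroup V] [Module ℝ V] [TopologicalSpace V]
    (P : Set V) : Prop :=
  IsCompact P ∧ Convex ℝ P ∧ (interior P).Nonempty

/-- A convex body containing `0` in its interior. -/
def IsZeroBody {V : Type*} [AddCommGroup V] [Module ℝ V] [TopologicalSpace V]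
    (P : Set V) : Prop :=
  IsCompact P ∧ Convex ℝ P ∧ 0 ∈ interior P

/-- A `0`-symmetric convex body. -/
def IsSymBody {V : Type*} [AddCommGroup V] [Module ℝ V] [TopologicalSpace V]
    (P : Set V) : Prop :=
  IsConvexBody P ∧ P = -P

/-- An assignment, to every `l`-tuple of finite-dimensional real inner product spaces
and every `l`-tuple of subsets thereof, of a subset of the tensor product space. -/
abbrev TPAssignment (l : ℕ) : Type 1 :=
  ∀ (E : Fin l → Type) [∀ i, NormedAddCommGroup (E i)] [∀ i, InnerProductSpace ℝ (E i)]
    [∀ i, FiniteDimensional ℝ (E i)], (∀ i, Set (E i)) → Set (⨂[ℝ] i, E i)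

/-- A tensor product of (order `l` of) convex bodies with zero in the interior:
on every tuple of convex bodies with `0` in the interior its value is a convex body
sandwiched between the projective and the injective tensor products, and it has the
uniform property. -/
def IsTPB (A : TPAssignment l) : Prop :=
  (∀ (E : Fin l → Type) [∀ i, NormedAddCommGroup (E i)] [∀ i, InnerProductSpace ℝ (E i)]
      [∀ i, FiniteDimensional ℝ (E i)] (P : ∀ i, Set (E i)), (∀ i, IsZeroBody (P i)) →
      IsConvexBody (A E P) ∧ projTP E P ⊆ A E P ∧ A E P ⊆ injTP E P) ∧
  (∀ (E F : Fin l → Type) [∀ i, NormedAddCommGroup (E i)] [∀ i, InnerProductSpace ℝ (E i)]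
      [∀ i, FiniteDimensional ℝ (E i)] [∀ i, NormedAddCommGroup (F i)]
      [∀ i, InnerProductSpace ℝ (F i)] [∀ i, FiniteDimensional ℝ (F i)]
      (P : ∀ i, Set (E i)) (Q : ∀ i, Set (F i)) (T : ∀ i, E i →ₗ[ℝ] F i),
      (∀ i, IsZeroBody (P i)) → (∀ i, IsZeroBody (Q i)) → (∀ i, T i '' P i ⊆ Q i) →
      PiTensorProduct.map T '' A E P ⊆ A F Q)

/-- A tensor product of (order `l` of) `0`-symmetric convex bodies. -/
def IsTPSym (A : TPAssignment l) : Prop :=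
  (∀ (E : Fin l → Type) [∀ i, NormedAddCommGroup (E i)] [∀ i, InnerProductSpace ℝ (E i)]
      [∀ i, FiniteDimensional ℝ (E i)] (P : ∀ i, Set (E i)), (∀ i, IsSymBody (P i)) →
      IsSymBody (A E P) ∧ projTP E P ⊆ A E P ∧ A E P ⊆ injTP E P) ∧
  (∀ (E F : Fin l → Type) [∀ i, NormedAddCommGroup (E i)] [∀ i, InnerProductSpace ℝ (E i)]
      [∀ i, FiniteDimensional ℝ (E i)] [∀ i, NormedAddCommGroup (F i)]
      [∀ i, InnerProductSpace ℝ (F i)] [∀ i, FiniteDimensional ℝ (F i)]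
      (P : ∀ i, Set (E i)) (Q : ∀ i, Set (F i)) (T : ∀ i, E i →ₗ[ℝ] F i),
      (∀ i, IsSymBody (P i)) → (∀ i, IsSymBody (Q i)) → (∀ i, T i '' P i ⊆ Q i) →
      PiTensorProduct.map T '' A E P ⊆ A F Q)

/-- The dual of an assignment: `P₁ ⊗_{α'} ⋯ ⊗_{α'} P_l = (P₁° ⊗_α ⋯ ⊗_α P_l°)°`. -/
def dualTP (A : TPAssignment l) : TPAssignment l :=
  fun E _ _ _ P =>
    polarB (tensorInner E) (A E (fun i => polarB (innerₗ (E i)) (P i)))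

/-- The order on tensor products of convex bodies with zero in the interior. -/
def leTPB (A B : TPAssignment l) : Prop :=
  ∀ (E : Fin l → Type) [∀ i, NormedAddCommGroup (E i)] [∀ i, InnerProductSpace ℝ (E i)]
    [∀ i, FiniteDimensional ℝ (E i)] (P : ∀ i, Set (E i)), (∀ i, IsZeroBody (P i)) →
    A E P ⊆ B E P

/-- The order on tensor products of `0`-symmetric convex bodies. -/
def leTPSym (A B : TPAssignment l) : Prop :=
  ∀ (E : Fin l → Type) [∀ i, NormedAddCommGroup (E i)] [∀ i, InnerProductSpace ℝ (E i)]
    [∀ i, FiniteDimensional ℝ (E i)] (P : ∀ i, Set (E i)), (∀ i, IsSymBody (P i)) →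
    A E P ⊆ B E P

/-- Injectivity of a tensor product of convex bodies: it respects sections by subspaces. -/
def IsInjectiveTPB (A : TPAssignment l) : Prop :=
  ∀ (E : Fin l → Type) [∀ i, NormedAddCommGroup (E i)] [∀ i, InnerProductSpace ℝ (E i)]
    [∀ i, FiniteDimensional ℝ (E i)] (P : ∀ i, Set (E i)) (M : ∀ i, Submodule ℝ (E i)),
    (∀ i, IsZeroBody (P i)) →
    PiTensorProduct.map (fun i => (M i).subtype) ''
        A (fun i => ↥(M i)) (fun i => Subtype.val ⁻¹' P i)
      = A E P ∩ Set.range (PiTensorProduct.map (fun i => (M i).subtype))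

/-- Projectivity of a tensor product of convex bodies: it respects quotients. -/
def IsProjectiveTPB (A : TPAssignment l) : Prop :=
  ∀ (E F : Fin l → Type) [∀ i, NormedAddCommGroup (E i)] [∀ i, InnerProductSpace ℝ (E i)]
    [∀ i, FiniteDimensional ℝ (E i)] [∀ i, NormedAddCommGroup (F i)]
    [∀ i, InnerProductSpace ℝ (F i)] [∀ i, FiniteDimensional ℝ (F i)]
    (P : ∀ i, Set (E i)) (T : ∀ i, E i →ₗ[ℝ] F i),
    (∀ i, IsZeroBody (P i)) → (∀ i, Function.Surjective (T i)) →
    PiTensorProduct.map T '' A E P = A F (fun i => T i '' P i)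

/-- Injectivity of a tensor product of `0`-symmetric convex bodies. -/
def IsInjectiveSym (A : TPAssignment l) : Prop :=
  ∀ (E : Fin l → Type) [∀ i, NormedAddCommGroup (E i)] [∀ i, InnerProductSpace ℝ (E i)]
    [∀ i, FiniteDimensional ℝ (E i)] (P : ∀ i, Set (E i)) (M : ∀ i, Submodule ℝ (E i)),
    (∀ i, IsSymBody (P i)) →
    PiTensorProduct.map (fun i => (M i).subtype) ''
        A (fun i => ↥(M i)) (fun i => Subtype.val ⁻¹' P i)
      = A E P ∩ Set.range (PiTensorProduct.map (fun i => (M i).subtype))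

/-- Projectivity of a tensor product of `0`-symmetric convex bodies. -/
def IsProjectiveSym (A : TPAssignment l) : Prop :=
  ∀ (E F : Fin l → Type) [∀ i, NormedAddCommGroup (E i)] [∀ i, InnerProductSpace ℝ (E i)]
    [∀ i, FiniteDimensional ℝ (E i)] [∀ i, NormedAddCommGroup (F i)]
    [∀ i, InnerProductSpace ℝ (F i)] [∀ i, FiniteDimensional ℝ (F i)]
    (P : ∀ i, Set (E i)) (T : ∀ i, E i →ₗ[ℝ] F i),
    (∀ i, IsSymBody (P i)) → (∀ i, Function.Surjective (T i)) →
    PiTensorProduct.map T '' A E P = A F (fun i => T i '' P i)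

/-- The intersection of all injective tensor products of convex bodies above `A`. -/
def injHullB (A : TPAssignment l) : TPAssignment l :=
  fun E _ _ _ P =>
    ⋂ B ∈ {B : TPAssignment l | IsTPB B ∧ IsInjectiveTPB B ∧ leTPB A B}, B E P

/-- The intersection of all injective tensor products of `0`-symmetric convex bodies
above `A`. -/
def injHullSym (A : TPAssignment l) : TPAssignment l :=
  fun E _ _ _ P =>
    ⋂ B ∈ {B : TPAssignment l | IsTPSym B ∧ IsInjectiveSym B ∧ leTPSym A B}, B E P

/-- The projective hull `⊗_{α^{proj}} = ⊗_{((α')^{inj})'}` (convex bodies version). -/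
def projHullB (A : TPAssignment l) : TPAssignment l :=
  dualTP (injHullB (dualTP A))

/-- The projective hull `⊗_{α^{proj}} = ⊗_{((α')^{inj})'}` (`0`-symmetric version). -/
def projHullSym (A : TPAssignment l) : TPAssignment l :=
  dualTP (injHullSym (dualTP A))

/-- The Banach–Mazur distance between `0`-symmetric convex bodies:
`inf {λ ≥ 1 : ∃ bijective linear T, Q ⊆ T(P) ⊆ λQ}`. -/
def deltaBM {V : Type*} [AddCommGroup V] [Module ℝ V] (P Q : Set V) : ℝ :=
  sInf {lam : ℝ | 1 ≤ lam ∧ ∃ T : V ≃ₗ[ℝ] V, Q ⊆ T '' P ∧ T '' P ⊆ lam • Q}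

/-- The projective tensor norm `π` on the tensor product of normed spaces. -/
def projNorm (M : Fin l → Type) [∀ i, NormedAddCommGroup (M i)] [∀ i, NormedSpace ℝ (M i)]
    (u : ⨂[ℝ] i, M i) : ℝ :=
  sInf {r | ∃ (n : ℕ) (x : Fin n → ∀ i, M i),
    u = (∑ j, ⨂ₜ[ℝ] i, x j i) ∧ r = ∑ j, ∏ i, ‖x j i‖}

/-- The injective tensor norm `ε` on the tensor product of normed spaces:
`ε(u) = sup {|x₁* ⊗ ⋯ ⊗ x_l* (u)| : ‖x_i*‖ ≤ 1}`. -/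
def injNorm (M : Fin l → Type) [∀ i, NormedAddCommGroup (M i)] [∀ i, NormedSpace ℝ (M i)]
    (u : ⨂[ℝ] i, M i) : ℝ :=
  sSup {r | ∃ f : ∀ i, M i →L[ℝ] ℝ, (∀ i, ‖f i‖ ≤ 1) ∧
    r = |PiTensorProduct.lift ((MultilinearMap.mkPiAlgebra ℝ (Fin l) ℝ).compLinearMap
        (fun i => (f i : M i →ₗ[ℝ] ℝ))) u|}

/-- An assignment of a real-valued function on the tensor product of every `l`-tuple of
finite-dimensional Banach spaces. -/
abbrev TNAssignment (l : ℕ) : Type 1 :=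
  ∀ (M : Fin l → Type) [∀ i, NormedAddCommGroup (M i)] [∀ i, NormedSpace ℝ (M i)]
    [∀ i, FiniteDimensional ℝ (M i)], (⨂[ℝ] i, M i) → ℝ

/-- A tensor norm of order `l` on the class of finite-dimensional Banach spaces:
on each tuple it is a norm which is a reasonable crossnorm (`ε ≤ α ≤ π`), and it
satisfies the uniform property. -/
def IsTensorNormFD (ν : TNAssignment l) : Prop :=
  (∀ (M : Fin l → Type) [∀ i, NormedAddCommGroup (M i)] [∀ i, NormedSpace ℝ (M i)]
      [∀ i, FiniteDimensional ℝ (M i)] (u v : ⨂[ℝ] i, M i),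
      ν M (u + v) ≤ ν M u + ν M v) ∧
  (∀ (M : Fin l → Type) [∀ i, NormedAddCommGroup (M i)] [∀ i, NormedSpace ℝ (M i)]
      [∀ i, FiniteDimensional ℝ (M i)] (c : ℝ) (u : ⨂[ℝ] i, M i),
      ν M (c • u) = |c| * ν M u) ∧
  (∀ (M : Fin l → Type) [∀ i, NormedAddCommGroup (M i)] [∀ i, NormedSpace ℝ (M i)]
      [∀ i, FiniteDimensional ℝ (M i)] (u : ⨂[ℝ] i, M i),
      ν M u = 0 → u = 0) ∧
  (∀ (M : Fin l → Type) [∀ i, NormedAddCommGroup (M i)] [∀ i, NormedSpace ℝ (M i)]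
      [∀ i, FiniteDimensional ℝ (M i)] (u : ⨂[ℝ] i, M i),
      injNorm M u ≤ ν M u ∧ ν M u ≤ projNorm M u) ∧
  (∀ (M N : Fin l → Type) [∀ i, NormedAddCommGroup (M i)] [∀ i, NormedSpace ℝ (M i)]
      [∀ i, FiniteDimensional ℝ (M i)] [∀ i, NormedAddCommGroup (N i)]
      [∀ i, NormedSpace ℝ (N i)] [∀ i, FiniteDimensional ℝ (N i)]
      (T : ∀ i, M i →L[ℝ] N i) (u : ⨂[ℝ] i, M i),
      ν N (PiTensorProduct.map (fun i => (T i : M i →ₗ[ℝ] N i)) u)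
        ≤ (∏ i, ‖T i‖) * ν M u)

/-- `Corresponds A ν` : the tensor product of `0`-symmetric convex bodies `A` and the
tensor norm `ν` correspond to each other under Minkowski's bijection, i.e. for every
tuple of `0`-symmetric convex bodies `P i ⊆ E i` and every isometric model
`e i : (M i, ‖·‖) ≃ (E i, g_{P i})` of the associated finite-dimensional Banach spaces,
`A E P` is the image of the closed unit ball of `ν` on `⨂ M i`. -/
def Corresponds (A : TPAssignment l) (ν : TNAssignment l) : Prop :=
  ∀ (E : Fin l → Type) [∀ i, NormedAddCommGroup (E i)] [∀ i, InnerProductSpace ℝ (E i)]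
    [∀ i, FiniteDimensional ℝ (E i)]
    (M : Fin l → Type) [∀ i, NormedAddCommGroup (M i)] [∀ i, NormedSpace ℝ (M i)]
    [∀ i, FiniteDimensional ℝ (M i)]
    (P : ∀ i, Set (E i)), (∀ i, IsSymBody (P i)) →
    ∀ (e : ∀ i, M i ≃ₗ[ℝ] E i), (∀ i (x : M i), ‖x‖ = gauge (P i) (e i x)) →
    A E P = PiTensorProduct.map (fun i => (e i : M i →ₗ[ℝ] E i)) '' {z | ν M z ≤ 1}

/-- A tensor norm is injective if the natural inclusions of subspace tensor products
are isometries. -/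
def IsInjectiveTN (ν : TNAssignment l) : Prop :=
  ∀ (X : Fin l → Type) [∀ i, NormedAddCommGroup (X i)] [∀ i, NormedSpace ℝ (X i)]
    [∀ i, FiniteDimensional ℝ (X i)] (S : ∀ i, Submodule ℝ (X i)) (u : ⨂[ℝ] i, ↥(S i)),
    ν (fun i => ↥(S i)) u = ν X (PiTensorProduct.map (fun i => (S i).subtype) u)

/-- A tensor norm is projective if tensor products of quotient operators (operators
mapping the open unit ball onto the open unit ball) are quotient operators. -/
def IsProjectiveTN (ν : TNAssignment l) : Prop :=
  ∀ (X Y : Fin l → Type) [∀ i, NormedAddCommGroup (X i)] [∀ i, NormedSpace ℝ (X i)]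
    [∀ i, FiniteDimensional ℝ (X i)] [∀ i, NormedAddCommGroup (Y i)]
    [∀ i, NormedSpace ℝ (Y i)] [∀ i, FiniteDimensional ℝ (Y i)]
    (T : ∀ i, X i →L[ℝ] Y i),
    (∀ i, (T i) '' Metric.ball 0 1 = Metric.ball 0 1) →
    {w : ⨂[ℝ] i, Y i | ν Y w < 1}
      = PiTensorProduct.map (fun i => (T i : X i →ₗ[ℝ] Y i)) '' {u | ν X u < 1}

/-- The canonical pairing between `⨂ (M i)*` and `⨂ M i`. -/
def dualPairing (M : Fin l → Type) [∀ i, NormedAddCommGroup (M i)]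
    [∀ i, NormedSpace ℝ (M i)] :
    (⨂[ℝ] i, (M i →L[ℝ] ℝ)) →ₗ[ℝ] (⨂[ℝ] i, M i) →ₗ[ℝ] ℝ :=
  (PiTensorProduct.map₂ (fun i => ContinuousLinearMap.coeLM ℝ)).compr₂
    (PiTensorProduct.lift (MultilinearMap.mkPiAlgebra ℝ (Fin l) ℝ))


/-- The projective tensor product `⊗_π` as an assignment. -/
def projA (l : ℕ) : TPAssignment l := fun E _ _ _ P => projTP E P

/-- The injective tensor product `⊗_ε` as an assignment. -/
def injA (l : ℕ) : TPAssignment l := fun E _ _ _ P => injTP E P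

/-- The pointwise order on assignments of tensor norms. -/
def leTN (ν₁ ν₂ : TNAssignment l) : Prop :=
  ∀ (M : Fin l → Type) [∀ i, NormedAddCommGroup (M i)] [∀ i, NormedSpace ℝ (M i)]
    [∀ i, FiniteDimensional ℝ (M i)] (z : ⨂[ℝ] i, M i), ν₁ M z ≤ ν₂ M z

/-- Pointwise equality of assignments of tensor norms. -/
def eqTN (ν₁ ν₂ : TNAssignment l) : Prop :=
  ∀ (M : Fin l → Type) [∀ i, NormedAddCommGroup (M i)] [∀ i, NormedSpace ℝ (M i)]
    [∀ i, FiniteDimensional ℝ (M i)] (z : ⨂[ℝ] i, M i), ν₁ M z = ν₂ M z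

/-- Equality of two assignments on all tuples of `0`-symmetric convex bodies. -/
def eqOnSymBodies (A A' : TPAssignment l) : Prop :=
  ∀ (E : Fin l → Type) [∀ i, NormedAddCommGroup (E i)] [∀ i, InnerProductSpace ℝ (E i)]
    [∀ i, FiniteDimensional ℝ (E i)] (P : ∀ i, Set (E i)), (∀ i, IsSymBody (P i)) →
    A E P = A' E P

/-- `ν'` is the dual tensor norm of `ν`:
`ν'(u) = sup {|φ(u)| : φ ∈ ⨂ᵢ Mᵢ*, ν_{M₁*,…,M_l*}(φ) ≤ 1}`. -/
def IsDualTN (ν ν' : TNAssignment l) : Prop :=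
  ∀ (M : Fin l → Type) [∀ i, NormedAddCommGroup (M i)] [∀ i, NormedSpace ℝ (M i)]
    [∀ i, FiniteDimensional ℝ (M i)] (u : ⨂[ℝ] i, M i),
    ν' M u = sSup {r | ∃ φ : ⨂[ℝ] i, (M i →L[ℝ] ℝ),
      ν (fun i => M i →L[ℝ] ℝ) φ ≤ 1 ∧ r = |dualPairing M φ u|}

/-- The image, under the continuous extension of `⨂ᵢ qᵢ` to the completed injective
tensor product `ℓ₁ ⊗̂_ε ⋯ ⊗̂_ε ℓ₁`, of the closed unit ball of that completion.
Since the closed unit ball of the completion is the closure of the closed unit ball of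
the algebraic injective tensor product `(⨂ᵢ ℓ₁, ε)`, and since the extension is
continuous, this image is exactly the set of limits of images of `ε`-Cauchy sequences
from the algebraic `ε`-unit ball. -/
def completedEpsBallImage {l : ℕ} (E : Fin l → Type) [∀ i, NormedAddCommGroup (E i)]
    [∀ i, InnerProductSpace ℝ (E i)]
    (q : ∀ i, lp (fun _ : ℕ => ℝ) 1 →ₗ[ℝ] E i) : Set (⨂[ℝ] i, E i) :=
  {y | ∃ u : ℕ → ⨂[ℝ] _i : Fin l, lp (fun _ : ℕ => ℝ) 1,
    (∀ n, injNorm (fun _ : Fin l => lp (fun _ : ℕ => ℝ) 1) (u n) ≤ 1) ∧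
    (∀ δ : ℝ, 0 < δ → ∃ N, ∀ m ≥ N, ∀ n ≥ N,
      injNorm (fun _ : Fin l => lp (fun _ : ℕ => ℝ) 1) (u m - u n) < δ) ∧
    Filter.Tendsto (fun n => PiTensorProduct.map q (u n)) Filter.atTop (nhds y)}

end

noncomputable section

section ConvexBodies

/-- The properties of a norm, as a predicate on real-valued functions. -/
structure IsNormFun {V : Type*} [AddCommGroup V] [Module ℝ V] (p : V → ℝ) : Prop where
  add_le : ∀ u v, p (u + v) ≤ p u + p v
  smul : ∀ (c : ℝ) u, p (c • u) = |c| * p u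
  eq_zero : ∀ u, p u = 0 → u = 0

theorem IsNormFun.map_zero {V : Type*} [AddCommGroup V] [Module ℝ V] {p : V → ℝ}
    (h : IsNormFun p) : p 0 = 0 := by
  simpa using h.smul 0 0

theorem IsNormFun.map_neg {V : Type*} [AddCommGroup V] [Module ℝ V] {p : V → ℝ}
    (h : IsNormFun p) (u : V) : p (-u) = p u := by
  simpa using h.smul (-1) u

theorem IsNormFun.nonneg {V : Type*} [AddCommGroup V] [Module ℝ V] {p : V → ℝ}
    (h : IsNormFun p) (u : V) : 0 ≤ p u := by
  have := h.add_le u (-u)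
  rw [add_neg_cancel, h.map_zero, h.map_neg] at this
  linarith

theorem isNormFun_norm (V : Type*) [NormedAddCommGroup V] [NormedSpace ℝ V] :
    IsNormFun (fun x : V => ‖x‖) :=
  ⟨norm_add_le, fun c u => by rw [norm_smul, Real.norm_eq_abs], fun u => norm_eq_zero.1⟩

/-- The vector space `V` normed by `p`. -/
def Renormed {V : Type*} [AddCommGroup V] [Module ℝ V] {p : V → ℝ} (_ : IsNormFun p) :
    Type _ := V

namespace Renormed

variable {V : Type*} [AddCommGroup V] [Module ℝ V] {p : V → ℝ} (h : IsNormFun p)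

instance : AddCommGroup (Renormed h) := inferInstanceAs (AddCommGroup V)

instance : Module ℝ (Renormed h) := inferInstanceAs (Module ℝ V)

/-- The identity map from the renormed space. -/
def equiv : Renormed h ≃ₗ[ℝ] V := LinearEquiv.refl ℝ V

instance : Norm (Renormed h) := ⟨fun x => p (equiv h x)⟩

theorem norm_def (x : Renormed h) : ‖x‖ = p (equiv h x) := rfl

theorem core : NormedSpace.Core ℝ (Renormed h) where
  norm_nonneg x := h.nonneg _
  norm_smul c x := by simp [norm_def, h.smul]
  norm_triangle x y := by simpa [norm_def] using h.add_le _ _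
  norm_eq_zero_iff x := by
    refine ⟨fun hx => (equiv h).map_eq_zero_iff.1 (h.eq_zero _ hx), ?_⟩
    rintro rfl
    simp [norm_def, h.map_zero]

instance : NormedAddCommGroup (Renormed h) := NormedAddCommGroup.ofCore (core h)

instance : NormedSpace ℝ (Renormed h) := NormedSpace.ofCore (core h)

instance [FiniteDimensional ℝ V] : FiniteDimensional ℝ (Renormed h) :=
  inferInstanceAs (FiniteDimensional ℝ V)

end Renormed

section

variable {V W : Type*} [AddCommGroup V] [Module ℝ V] [TopologicalSpace V]
  [IsTopologicalAddGroup V] [ContinuousSMul ℝ V]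

theorem isSymBody_image_closedBall [T2Space V] [NormedAddCommGroup W] [NormedSpace ℝ W]
    [FiniteDimensional ℝ W] (e : W ≃ₗ[ℝ] V) : IsSymBody (e '' Metric.closedBall 0 1) := by
  have := e.finiteDimensional
  have := FiniteDimensional.proper_real W
  have hcont : Continuous e := LinearMap.continuous_of_finiteDimensional (e : W →ₗ[ℝ] V)
  have hcont' : Continuous e.symm :=
    LinearMap.continuous_of_finiteDimensional (e.symm : V →ₗ[ℝ] W)
  refine ⟨⟨(isCompact_closedBall 0 1).image hcont,
    (convex_closedBall 0 1).linear_image (e : W →ₗ[ℝ] V), 0, ?_⟩, ?_⟩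
  · rw [mem_interior_iff_mem_nhds, e.image_eq_preimage_symm]
    apply hcont'.continuousAt.preimage_mem_nhds
    rw [map_zero]
    exact Metric.closedBall_mem_nhds 0 one_pos
  · ext x
    simp only [e.image_eq_preimage_symm, Set.mem_neg, Set.mem_preimage, mem_closedBall_zero_iff,
      _root_.map_neg, norm_neg]

theorem IsNormFun.isSymBody [T2Space V] [FiniteDimensional ℝ V] {p : V → ℝ}
    (h : IsNormFun p) : IsSymBody {x | p x ≤ 1} := by
  convert isSymBody_image_closedBall (Renormed.equiv h)
  ext x
  rw [LinearEquiv.image_eq_preimage_symm, Set.mem_preimage, mem_closedBall_zero_iff,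
    Renormed.norm_def, LinearEquiv.apply_symm_apply]
  rfl

namespace IsSymBody

variable {P : Set V} (hP : IsSymBody P)
include hP

omit [IsTopologicalAddGroup V] [ContinuousSMul ℝ V] in
theorem neg_mem {x : V} (hx : x ∈ P) : -x ∈ P := by
  rw [hP.2]
  simpa using hx

theorem mem_nhds_zero : P ∈ nhds (0 : V) := by
  rw [← mem_interior_iff_mem_nhds]
  obtain ⟨x, hx⟩ := hP.1.2.2
  have hx' : -x ∈ interior P := by
    have := (Homeomorph.neg V).preimage_interior P
    rw [Homeomorph.coe_neg, Set.neg_preimage, Set.neg_preimage, ← hP.2] at this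
    rwa [← Set.mem_neg, this]
  have := hP.1.2.1.interior hx hx' (a := 1 / 2) (b := 1 / 2) (by norm_num) (by norm_num)
    (by norm_num)
  simpa using this

theorem zero_mem : (0 : V) ∈ P := mem_of_mem_nhds hP.mem_nhds_zero

theorem isNormFun_gauge [T2Space V] : IsNormFun (gauge P) where
  add_le := gauge_add_le hP.1.2.1 (absorbent_nhds_zero hP.mem_nhds_zero)
  smul c u := by
    rcases le_total 0 c with hc | hc
    · rw [gauge_smul_of_nonneg hc, abs_of_nonneg hc, smul_eq_mul]
    · rw [← gauge_neg (fun x => hP.neg_mem), ← neg_smul,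
        gauge_smul_of_nonneg (neg_nonneg.2 hc), abs_of_nonpos hc, smul_eq_mul]
  eq_zero u hu :=
    (gauge_eq_zero (absorbent_nhds_zero hP.mem_nhds_zero)
      (letI := IsTopologicalAddGroup.rightUniformSpace V
       haveI := isUniformAddGroup_of_addCommGroup (G := V)
       hP.1.1.isVonNBounded ℝ)).1 hu

theorem gauge_le_one_iff [T2Space V] (x : V) : gauge P x ≤ 1 ↔ x ∈ P := by
  rw [gauge_le_one_iff_mem_closure hP.1.2.1 hP.mem_nhds_zero, hP.1.1.isClosed.closure_eq]

end IsSymBody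

end

theorem le_one_of_forall_lt {f g : ℝ} (hf : 0 ≤ f)
    (h : ∀ c : ℝ, 0 < c → c * f ≤ 1 → c * g ≤ 1) : g ≤ f := by
  refine le_of_forall_gt fun r hr => ?_
  obtain ⟨s, hs, hsr⟩ := exists_between hr
  have hs0 : 0 < s := hf.trans_lt hs
  have := h s⁻¹ (inv_pos.2 hs0) (by rw [inv_mul_le_iff₀ hs0]; linarith)
  rw [inv_mul_le_iff₀ hs0] at this
  linarith

/-- A norm is determined by its unit ball. -/
theorem IsNormFun.le_of_ball_subset {V W : Type*} [AddCommGroup V] [Module ℝ V]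
    [AddCommGroup W] [Module ℝ W] {p : V → ℝ} {q : W → ℝ} (hp : IsNormFun p)
    (hq : IsNormFun q) (T : V →ₗ[ℝ] W) (h : ∀ u, p u ≤ 1 → q (T u) ≤ 1) (u : V) :
    q (T u) ≤ p u := by
  refine le_one_of_forall_lt (hp.nonneg _) fun c hc hu => ?_
  have := h (c • u) (by rwa [hp.smul, abs_of_pos hc])
  rwa [_root_.map_smul, hq.smul, abs_of_pos hc] at this

theorem image_ball_eq_iff {X Y : Type*} [NormedAddCommGroup X] [NormedSpace ℝ X]
    [FiniteDimensional ℝ X] [NormedAddCommGroup Y] [NormedSpace ℝ Y] (T : X →ₗ[ℝ] Y) :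
    T '' Metric.ball 0 1 = Metric.ball 0 1 ↔
      T '' Metric.closedBall 0 1 = Metric.closedBall 0 1 := by
  have := FiniteDimensional.proper_real X
  have hT : Continuous T := LinearMap.continuous_of_finiteDimensional T
  constructor
  · intro h
    apply Set.Subset.antisymm
    · rw [← closure_ball (0 : X) one_ne_zero, ← closure_ball (0 : Y) one_ne_zero, ← h]
      exact image_closure_subset_closure_image hT
    · rw [← closure_ball (0 : Y) one_ne_zero, ← h]
      exact closure_minimal (Set.image_mono Metric.ball_subset_closedBall)
        ((isCompact_closedBall 0 1).image hT).isClosed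
  · intro h
    have hle : ∀ x, ‖T x‖ ≤ ‖x‖ := (isNormFun_norm X).le_of_ball_subset (isNormFun_norm Y) T
      fun u hu => by
        have : T u ∈ T '' Metric.closedBall 0 1 := ⟨u, by simpa using hu, rfl⟩
        rw [h] at this
        simpa using this
    ext w
    constructor
    · rintro ⟨x, hx, rfl⟩
      rw [mem_ball_zero_iff] at *
      exact (hle x).trans_lt hx
    · intro hw
      rw [mem_ball_zero_iff] at hw
      rcases eq_or_ne w 0 with rfl | hw0
      · exact ⟨0, by simp, by simp⟩
      · have h0 : 0 < ‖w‖ := norm_pos_iff.2 hw0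
        have : ‖w‖⁻¹ • w ∈ T '' Metric.closedBall 0 1 := by
          rw [h, mem_closedBall_zero_iff, norm_smul, norm_inv, norm_norm, inv_mul_cancel₀ h0.ne']
        obtain ⟨x, hx, hxw⟩ := this
        refine ⟨‖w‖ • x, ?_, by rw [_root_.map_smul, hxw, smul_inv_smul₀ h0.ne']⟩
        rw [mem_ball_zero_iff, norm_smul, norm_norm]
        rw [mem_closedBall_zero_iff] at hx
        nlinarith

theorem IsNormFun.image_ball_eq_iff {V W : Type*} [AddCommGroup V] [Module ℝ V]
    [FiniteDimensional ℝ V] [AddCommGroup W] [Module ℝ W] {p : V → ℝ} {q : W → ℝ}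
    (hp : IsNormFun p) (hq : IsNormFun q) (T : V →ₗ[ℝ] W) :
    T '' {u | p u < 1} = {w | q w < 1} ↔ T '' {u | p u ≤ 1} = {w | q w ≤ 1} := by
  have := _root_.image_ball_eq_iff
    ((Renormed.equiv hq).symm.toLinearMap ∘ₗ T ∘ₗ (Renormed.equiv hp).toLinearMap)
  have h1 : (Metric.ball (0 : Renormed hp) 1) = (Renormed.equiv hp) ⁻¹' {u | p u < 1} := by
    ext x; rw [mem_ball_zero_iff]; rfl
  have h2 : (Metric.ball (0 : Renormed hq) 1) = (Renormed.equiv hq) ⁻¹' {u | q u < 1} := by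
    ext x; rw [mem_ball_zero_iff]; rfl
  have h3 : (Metric.closedBall (0 : Renormed hp) 1) = (Renormed.equiv hp) ⁻¹' {u | p u ≤ 1} := by
    ext x; rw [mem_closedBall_zero_iff]; rfl
  have h4 : (Metric.closedBall (0 : Renormed hq) 1) = (Renormed.equiv hq) ⁻¹' {u | q u ≤ 1} := by
    ext x; rw [mem_closedBall_zero_iff]; rfl
  rw [h1, h2, h3, h4] at this
  simpa only [LinearMap.coe_comp, LinearEquiv.coe_coe, Set.image_comp,
    Set.image_preimage_eq _ (Renormed.equiv hp).surjective, LinearEquiv.image_symm_eq_preimage,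
    (Set.preimage_injective.2 (Renormed.equiv hq).surjective).eq_iff] using this


end ConvexBodies

section Polar

variable {V W : Type*} [AddCommGroup V] [Module ℝ V] [AddCommGroup W] [Module ℝ W]

theorem polarB_antitone (B : V →ₗ[ℝ] V →ₗ[ℝ] ℝ) {C D : Set V} (h : C ⊆ D) :
    polarB B D ⊆ polarB B C :=
  fun _ hz u hu => hz u (h hu)

theorem subset_polarB_polarB {B : V →ₗ[ℝ] V →ₗ[ℝ] ℝ} (hB : ∀ u v, B u v = B v u) (C : Set V) :
    C ⊆ polarB B (polarB B C) :=
  fun u hu z hz => hB z u ▸ hz u hu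

theorem polarB_image (B : V →ₗ[ℝ] V →ₗ[ℝ] ℝ) (B' : W →ₗ[ℝ] W →ₗ[ℝ] ℝ) (T : V →ₗ[ℝ] W)
    (S : W →ₗ[ℝ] V) (h : ∀ u w, B' (T u) w = B u (S w)) (C : Set V) :
    polarB B' (T '' C) = S ⁻¹' polarB B C := by
  ext w
  simp [polarB, h]

theorem exists_eq_flip [FiniteDimensional ℝ V] {B : V →ₗ[ℝ] V →ₗ[ℝ] ℝ}
    (hnd : ∀ z, (∀ u, B u z = 0) → z = 0) (f : V →ₗ[ℝ] ℝ) : ∃ z, ∀ u, f u = B u z := by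
  have hinj : Function.Injective B.flip := by
    rw [← LinearMap.ker_eq_bot, LinearMap.ker_eq_bot']
    exact fun z hz => hnd z fun u => LinearMap.congr_fun hz u
  obtain ⟨z, hz⟩ := (LinearMap.injective_iff_surjective_of_finrank_eq_finrank
    (Subspace.dual_finrank_eq (K := ℝ) (V := V)).symm).1 hinj f
  exact ⟨z, fun u => by rw [← hz]; rfl⟩

variable [TopologicalSpace V] [IsTopologicalAddGroup V] [ContinuousSMul ℝ V]

theorem bipolar [LocallyConvexSpace ℝ V] [FiniteDimensional ℝ V] {B : V →ₗ[ℝ] V →ₗ[ℝ] ℝ}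
    (hB : ∀ u v, B u v = B v u) (hnd : ∀ z, (∀ u, B u z = 0) → z = 0) {C : Set V}
    (hconv : Convex ℝ C) (hcl : IsClosed C) (h0 : 0 ∈ C) : polarB B (polarB B C) = C := by
  refine Set.Subset.antisymm (fun x hx => ?_) (subset_polarB_polarB hB C)
  by_contra hxC
  obtain ⟨f, u, hfu, hux⟩ := geometric_hahn_banach_closed_point hconv hcl hxC
  have hu : 0 < u := by simpa using hfu 0 h0
  obtain ⟨z, hz⟩ := exists_eq_flip hnd (f : V →ₗ[ℝ] ℝ)
  have hzC : u⁻¹ • z ∈ polarB B C := fun a ha => by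
    rw [_root_.map_smul, ← hz, smul_eq_mul, inv_mul_le_iff₀ hu, mul_one]
    exact (hfu a ha).le
  have := hx _ hzC
  rw [hB, _root_.map_smul, ← hz, smul_eq_mul, inv_mul_le_iff₀ hu, mul_one] at this
  exact absurd hux (not_lt.2 this)

theorem IsSymBody.polarB [T2Space V] [FiniteDimensional ℝ V] {B : V →ₗ[ℝ] V →ₗ[ℝ] ℝ}
    (hnd : ∀ z, (∀ u, B u z = 0) → z = 0) {C : Set V} (hC : IsSymBody C) :
    IsSymBody (polarB B C) := by
  have hbdd : ∀ z, BddAbove ((fun u => B u z) '' C) := fun z =>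
    (hC.1.1.image (LinearMap.continuous_of_finiteDimensional (B.flip z))).bddAbove
  have hne : ∀ z, ((fun u => B u z) '' C).Nonempty := fun z => Set.Nonempty.image _ ⟨0, hC.zero_mem⟩
  have hle : ∀ z, ∀ u ∈ C, B u z ≤ sSup ((fun u => B u z) '' C) := fun z u hu =>
    le_csSup (hbdd z) ⟨u, hu, rfl⟩
  have hneg : ∀ z, ∀ u ∈ C, -B u z ≤ sSup ((fun u => B u z) '' C) := fun z u hu => by
    simpa using hle z (-u) (hC.neg_mem hu)
  have hnonneg : ∀ z, 0 ≤ sSup ((fun u => B u z) '' C) := fun z => by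
    simpa using hle z 0 hC.zero_mem
  have hsmul : ∀ (c : ℝ) z, sSup ((fun u => B u (c • z)) '' C)
      ≤ |c| * sSup ((fun u => B u z) '' C) := by
    refine fun c z => csSup_le (hne _) ?_
    rintro _ ⟨u, hu, rfl⟩
    simp only [_root_.map_smul, smul_eq_mul]
    rcases abs_cases c with ⟨h, h'⟩ | ⟨h, h'⟩ <;> rw [h]
    · exact mul_le_mul_of_nonneg_left (hle z u hu) h'
    · nlinarith [hneg z u hu]
  have hp : IsNormFun fun z => sSup ((fun u => B u z) '' C) := by
    refine ⟨fun z w => csSup_le (hne _) ?_, fun c z => (hsmul c z).antisymm ?_, fun z hz => ?_⟩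
    · rintro _ ⟨u, hu, rfl⟩
      simp only [map_add]
      exact add_le_add (hle z u hu) (hle w u hu)
    · rcases eq_or_ne c 0 with rfl | hc
      · simpa using hnonneg 0
      · have := hsmul c⁻¹ (c • z)
        rw [inv_smul_smul₀ hc, abs_inv] at this
        rwa [le_inv_mul_iff₀ (abs_pos.2 hc)] at this
    · refine hnd z fun u => ?_
      obtain ⟨r, hr, hu⟩ := ((absorbent_nhds_zero (𝕜 := ℝ) hC.mem_nhds_zero).absorbs
        (x := u)).exists_pos
      obtain ⟨v, hv, hvu⟩ := hu r (by rw [Real.norm_of_nonneg hr.le]) (Set.mem_singleton u)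
      have h1 := hle z v hv
      have h2 := hneg z v hv
      rw [hz] at h1 h2
      have h3 : B v z = 0 := by linarith
      rw [← hvu]
      simp [h3]
  convert hp.isSymBody
  ext z
  refine ⟨fun hz => csSup_le (hne z) ?_, fun hz u hu => (hle z u hu).trans hz⟩
  rintro _ ⟨u, hu, rfl⟩
  exact hz u hu

end Polar

section Tensor

section Topology

variable (E : Fin l → Type) [∀ i, NormedAddCommGroup (E i)] [∀ i, InnerProductSpace ℝ (E i)]

instance : IsTopologicalAddGroup (⨂[ℝ] i, E i) :=
  topologicalAddGroup_iInf fun f => topologicalAddGroup_induced f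

instance : ContinuousSMul ℝ (⨂[ℝ] i, E i) :=
  continuousSMul_iInf fun f => continuousSMul_induced f

instance : LocallyConvexSpace ℝ (⨂[ℝ] i, E i) :=
  LocallyConvexSpace.iInf fun f => LocallyConvexSpace.induced f

theorem continuous_tensor_functional (f : (⨂[ℝ] i, E i) →ₗ[ℝ] ℝ) : Continuous f :=
  continuous_iInf_dom (i := f) continuous_induced_dom

instance : T2Space (⨂[ℝ] i, E i) := by
  refine ⟨fun x y hxy => ?_⟩
  have : ∃ f : (⨂[ℝ] i, E i) →ₗ[ℝ] ℝ, f x ≠ f y := by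
    by_contra! h
    exact hxy (sub_eq_zero.1 ((Module.forall_dual_apply_eq_zero_iff ℝ _).1 fun f => by
      rw [map_sub, h f, sub_self]))
  obtain ⟨f, hf⟩ := this
  exact separated_by_continuous (continuous_tensor_functional E f) hf

end Topology

section Inner

variable (E F : Fin l → Type) [∀ i, NormedAddCommGroup (E i)] [∀ i, InnerProductSpace ℝ (E i)]
  [∀ i, NormedAddCommGroup (F i)] [∀ i, InnerProductSpace ℝ (F i)]

theorem tensorInner_tprod (x y : ∀ i, E i) :
    tensorInner E (⨂ₜ[ℝ] i, x i) (⨂ₜ[ℝ] i, y i) = ∏ i, ⟪x i, y i⟫ := by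
  simp [tensorInner, PiTensorProduct.map₂_tprod_tprod]

theorem tensorInner_map (T : ∀ i, E i →ₗ[ℝ] F i) (S : ∀ i, F i →ₗ[ℝ] E i)
    (h : ∀ i x y, ⟪T i x, y⟫ = ⟪x, S i y⟫) (u : ⨂[ℝ] i, E i) (w : ⨂[ℝ] i, F i) :
    tensorInner F (PiTensorProduct.map T u) w = tensorInner E u (PiTensorProduct.map S w) := by
  have : (tensorInner F).comp (PiTensorProduct.map T) =
      (tensorInner E).compl₂ (PiTensorProduct.map S) := by
    ext x y
    simp [tensorInner_tprod, h]
  exact LinearMap.congr_fun (LinearMap.congr_fun this u) w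

theorem tensorInner_comm (u v : ⨂[ℝ] i, E i) : tensorInner E u v = tensorInner E v u := by
  have : tensorInner E = (tensorInner E).flip := by
    ext x y
    simp [tensorInner_tprod, real_inner_comm]
  exact LinearMap.congr_fun (LinearMap.congr_fun this u) v

theorem tensorInner_nondegenerate [∀ i, FiniteDimensional ℝ (E i)] (z : ⨂[ℝ] i, E i)
    (hz : ∀ u, tensorInner E u z = 0) : z = 0 := by
  let b := fun i => stdOrthonormalBasis ℝ (E i)
  let β := Basis.piTensorProduct fun i => (b i).toBasis
  have key : ∀ p, tensorInner E (β p) = β.coord p := fun p => by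
    ext x
    simp [β, tensorInner_tprod, OrthonormalBasis.repr_apply_apply]
  refine β.ext_elem fun p => ?_
  rw [← Module.Basis.coord_apply, ← key, hz, _root_.map_zero, Finsupp.zero_apply]

theorem innerₗ_nondegenerate (H : Type*) [NormedAddCommGroup H] [InnerProductSpace ℝ H] (z : H)
    (hz : ∀ u, innerₗ H u z = 0) : z = 0 :=
  inner_self_eq_zero.1 (hz z)

theorem innerₗ_comm (H : Type*) [NormedAddCommGroup H] [InnerProductSpace ℝ H] (u v : H) :
    innerₗ H u v = innerₗ H v u :=
  real_inner_comm v u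

end Inner

end Tensor

section Correspondence

section Models

variable {M E : Type*} [NormedAddCommGroup M] [NormedSpace ℝ M] [NormedAddCommGroup E]
  [NormedSpace ℝ E]

/-- `e` identifies `M` with the space normed by the gauge of `P`. -/
def IsModel (P : Set E) (e : M ≃ₗ[ℝ] E) : Prop :=
  ∀ x, ‖x‖ = gauge P (e x)

theorem isModel_image (e : M ≃ₗ[ℝ] E) : IsModel (e '' Metric.closedBall 0 1) e := by
  intro x
  have h := gauge_closedBall (zero_le_one' ℝ) x
  rw [div_one] at h
  rw [← h, gauge_def', gauge_def', e.image_eq_preimage_symm]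
  congr 1
  ext r
  simp

theorem isModel_renormed {P : Set E} (hP : IsSymBody P) :
    IsModel P (Renormed.equiv hP.isNormFun_gauge) :=
  fun _ => rfl

theorem IsModel.mem_iff {P : Set E} {e : M ≃ₗ[ℝ] E} (he : IsModel P e) (hP : IsSymBody P)
    (x : M) : e x ∈ P ↔ ‖x‖ ≤ 1 := by
  rw [he, hP.gauge_le_one_iff]

theorem IsModel.image_closedBall {P : Set E} {e : M ≃ₗ[ℝ] E} (he : IsModel P e)
    (hP : IsSymBody P) : e '' Metric.closedBall 0 1 = P := by
  ext x
  rw [e.image_eq_preimage_symm, Set.mem_preimage, mem_closedBall_zero_iff, ← he.mem_iff hP,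
    e.apply_symm_apply]

/-- A model of a finite-dimensional normed space on a Euclidean space. -/
def stdEquiv (M : Type*) [NormedAddCommGroup M] [NormedSpace ℝ M] [FiniteDimensional ℝ M] :
    M ≃ₗ[ℝ] EuclideanSpace ℝ (Fin (Module.finrank ℝ M)) :=
  LinearEquiv.ofFinrankEq _ _ (by simp)

theorem IsModel.submodule {P : Set E} {e : M ≃ₗ[ℝ] E} (he : IsModel P e) {S : Submodule ℝ M}
    {N : Submodule ℝ E} (h : S.map (e : M →ₗ[ℝ] E) = N) :
    IsModel (Subtype.val ⁻¹' P : Set N) (e.ofSubmodules S N h) := by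
  intro x
  have : ‖x‖ = ‖(x : M)‖ := rfl
  rw [this, he, gauge_def', gauge_def']
  congr 1

theorem isSymBody_preimage [FiniteDimensional ℝ M] [FiniteDimensional ℝ E] {P : Set E}
    (hP : IsSymBody P) (S : M →ₗ[ℝ] E) (hS : Function.Injective S) : IsSymBody (S ⁻¹' P) := by
  have h := hP.isNormFun_gauge
  have : IsNormFun fun x => gauge P (S x) :=
    ⟨fun u v => by rw [map_add]; exact h.add_le _ _,
      fun c u => by rw [_root_.map_smul]; exact h.smul c _,
      fun u hu => (map_eq_zero_iff S hS).1 (h.eq_zero _ hu)⟩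
  convert this.isSymBody
  ext x
  exact (hP.gauge_le_one_iff _).symm

theorem isSymBody_image [FiniteDimensional ℝ M] [FiniteDimensional ℝ E] {P : Set M}
    (hP : IsSymBody P) (T : M →ₗ[ℝ] E) (hT : Function.Surjective T) : IsSymBody (T '' P) := by
  refine ⟨⟨hP.1.1.image (LinearMap.continuous_of_finiteDimensional T),
    hP.1.2.1.linear_image T, ?_⟩, ?_⟩
  · exact (hP.1.2.2.image T).mono
      (((T.isOpenMap_of_finiteDimensional hT).image_interior_subset P))
  · ext x
    rw [Set.mem_neg]
    constructor
    · rintro ⟨y, hy, rfl⟩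
      exact ⟨-y, hP.neg_mem hy, _root_.map_neg T y⟩
    · rintro ⟨y, hy, hyx⟩
      exact ⟨-y, hP.neg_mem hy, by rw [_root_.map_neg, hyx, neg_neg]⟩

end Models

section TensorNorm

variable {ν : TNAssignment l} (hν : IsTensorNormFD ν)
include hν

theorem IsTensorNormFD.isNormFun (M : Fin l → Type) [∀ i, NormedAddCommGroup (M i)]
    [∀ i, NormedSpace ℝ (M i)] [∀ i, FiniteDimensional ℝ (M i)] : IsNormFun (ν M) :=
  ⟨hν.1 M, hν.2.1 M, hν.2.2.1 M⟩

theorem IsTensorNormFD.map_le {M N : Fin l → Type} [∀ i, NormedAddCommGroup (M i)]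
    [∀ i, NormedSpace ℝ (M i)] [∀ i, FiniteDimensional ℝ (M i)] [∀ i, NormedAddCommGroup (N i)]
    [∀ i, NormedSpace ℝ (N i)] [∀ i, FiniteDimensional ℝ (N i)] (T : ∀ i, M i →ₗ[ℝ] N i)
    (hT : ∀ i x, ‖T i x‖ ≤ ‖x‖) (u : ⨂[ℝ] i, M i) :
    ν N (PiTensorProduct.map T u) ≤ ν M u := by
  refine (hν.2.2.2.2 M N (fun i => (T i).toContinuousLinearMap) u).trans ?_
  refine mul_le_of_le_one_left ((hν.isNormFun M).nonneg u)
    (Finset.prod_le_one (fun i _ => norm_nonneg _) fun i _ => ?_)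
  exact ContinuousLinearMap.opNorm_le_bound _ zero_le_one fun x => by simpa using hT i x

theorem IsTensorNormFD.map_isometry {M N : Fin l → Type} [∀ i, NormedAddCommGroup (M i)]
    [∀ i, NormedSpace ℝ (M i)] [∀ i, FiniteDimensional ℝ (M i)] [∀ i, NormedAddCommGroup (N i)]
    [∀ i, NormedSpace ℝ (N i)] [∀ i, FiniteDimensional ℝ (N i)] (φ : ∀ i, M i ≃ₗ[ℝ] N i)
    (hφ : ∀ i x, ‖φ i x‖ = ‖x‖) (u : ⨂[ℝ] i, M i) :
    ν N (PiTensorProduct.congr φ u) = ν M u := by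
  refine le_antisymm (hν.map_le (fun i => (φ i : M i →ₗ[ℝ] N i)) (fun i x => (hφ i x).le) u) ?_
  have := hν.map_le (fun i => ((φ i).symm : N i →ₗ[ℝ] M i))
    (fun i x => by simpa using (hφ i ((φ i).symm x)).ge) (PiTensorProduct.congr φ u)
  rwa [show PiTensorProduct.map (fun i => ((φ i).symm : N i →ₗ[ℝ] M i))
    (PiTensorProduct.congr φ u) = u from (PiTensorProduct.congr φ).symm_apply_apply u] at this

theorem IsTensorNormFD.tprod_le (M : Fin l → Type) [∀ i, NormedAddCommGroup (M i)]
    [∀ i, NormedSpace ℝ (M i)] [∀ i, FiniteDimensional ℝ (M i)] (x : ∀ i, M i) :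
    ν M (⨂ₜ[ℝ] i, x i) ≤ ∏ i, ‖x i‖ := by
  refine ((hν.2.2.2.1 M _).2).trans (csInf_le ⟨0, ?_⟩ ⟨1, fun _ => x, by simp, by simp⟩)
  rintro _ ⟨n, y, -, rfl⟩
  positivity

end TensorNorm

theorem bddAbove_injNorm (M : Fin l → Type) [∀ i, NormedAddCommGroup (M i)]
    [∀ i, NormedSpace ℝ (M i)] (u : ⨂[ℝ] i, M i) :
    BddAbove {r | ∃ f : ∀ i, M i →L[ℝ] ℝ, (∀ i, ‖f i‖ ≤ 1) ∧
      r = |PiTensorProduct.lift ((MultilinearMap.mkPiAlgebra ℝ (Fin l) ℝ).compLinearMap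
        (fun i => (f i : M i →ₗ[ℝ] ℝ))) u|} := by
  induction u using PiTensorProduct.induction_on with
  | smul_tprod r x =>
    refine ⟨|r| * ∏ i, ‖x i‖, ?_⟩
    rintro _ ⟨f, hf, rfl⟩
    simp only [_root_.map_smul, lift.tprod, MultilinearMap.compLinearMap_apply,
      MultilinearMap.mkPiAlgebra_apply, smul_eq_mul, abs_mul, Finset.abs_prod]
    gcongr with i
    exact (f i).le_of_opNorm_le (hf i) (x i) |>.trans_eq (one_mul _)
  | add a b ha hb =>
    obtain ⟨C, hC⟩ := ha
    obtain ⟨D, hD⟩ := hb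
    refine ⟨C + D, ?_⟩
    rintro _ ⟨f, hf, rfl⟩
    rw [map_add]
    exact (abs_add_le _ _).trans (add_le_add (hC ⟨f, hf, rfl⟩) (hD ⟨f, hf, rfl⟩))

theorem le_injNorm (M : Fin l → Type) [∀ i, NormedAddCommGroup (M i)]
    [∀ i, NormedSpace ℝ (M i)] (u : ⨂[ℝ] i, M i) (f : ∀ i, M i →L[ℝ] ℝ) (hf : ∀ i, ‖f i‖ ≤ 1) :
    |PiTensorProduct.lift ((MultilinearMap.mkPiAlgebra ℝ (Fin l) ℝ).compLinearMap
        (fun i => (f i : M i →ₗ[ℝ] ℝ))) u| ≤ injNorm M u :=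
  le_csSup (bddAbove_injNorm M u) ⟨f, hf, rfl⟩

section Corresponds

variable {A : TPAssignment l} {ν : TNAssignment l}

section

variable {E : Fin l → Type} [∀ i, NormedAddCommGroup (E i)] [∀ i, InnerProductSpace ℝ (E i)]
    [∀ i, FiniteDimensional ℝ (E i)]
    {M : Fin l → Type} [∀ i, NormedAddCommGroup (M i)] [∀ i, NormedSpace ℝ (M i)]
    [∀ i, FiniteDimensional ℝ (M i)] {P : ∀ i, Set (E i)} {e : ∀ i, M i ≃ₗ[ℝ] E i}

theorem Corresponds.eq_image (hC : Corresponds A ν) (hP : ∀ i, IsSymBody (P i))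
    (he : ∀ i, IsModel (P i) (e i)) :
    A E P = PiTensorProduct.congr e '' {z | ν M z ≤ 1} :=
  hC E M P hP e he

theorem Corresponds.congr_mem_iff (hC : Corresponds A ν) (hP : ∀ i, IsSymBody (P i))
    (he : ∀ i, IsModel (P i) (e i)) (u : ⨂[ℝ] i, M i) :
    PiTensorProduct.congr e u ∈ A E P ↔ ν M u ≤ 1 := by
  rw [hC.eq_image hP he, (PiTensorProduct.congr e).injective.mem_set_image]
  rfl

theorem Corresponds.mem_iff (hC : Corresponds A ν) (hP : ∀ i, IsSymBody (P i))
    (he : ∀ i, IsModel (P i) (e i)) (z : ⨂[ℝ] i, E i) :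
    z ∈ A E P ↔ ν M ((PiTensorProduct.congr e).symm z) ≤ 1 := by
  rw [← hC.congr_mem_iff hP he, LinearEquiv.apply_symm_apply]

end

theorem stdEquiv_isSymBody (M : Type*) [NormedAddCommGroup M] [NormedSpace ℝ M]
    [FiniteDimensional ℝ M] : IsSymBody (stdEquiv M '' Metric.closedBall 0 1) :=
  isSymBody_image_closedBall (stdEquiv M)

theorem congr_map_comm {M N E F : Fin l → Type} [∀ i, AddCommGroup (M i)] [∀ i, Module ℝ (M i)]
    [∀ i, AddCommGroup (N i)] [∀ i, Module ℝ (N i)] [∀ i, AddCommGroup (E i)]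
    [∀ i, Module ℝ (E i)] [∀ i, AddCommGroup (F i)] [∀ i, Module ℝ (F i)]
    (e : ∀ i, M i ≃ₗ[ℝ] E i) (f : ∀ i, N i ≃ₗ[ℝ] F i) (T : ∀ i, M i →ₗ[ℝ] N i)
    (S : ∀ i, E i →ₗ[ℝ] F i) (h : ∀ i x, S i (e i x) = f i (T i x)) (u : ⨂[ℝ] i, M i) :
    PiTensorProduct.map S (PiTensorProduct.congr e u) =
      PiTensorProduct.congr f (PiTensorProduct.map T u) := by
  have : PiTensorProduct.map S ∘ₗ (PiTensorProduct.congr e).toLinearMap =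
      (PiTensorProduct.congr f).toLinearMap ∘ₗ PiTensorProduct.map T := by
    ext x
    simp [h]
  exact LinearMap.congr_fun this u

/-- The assignment of unit balls of a tensor norm, transported to inner product spaces. -/
def bodyOf (ν : TNAssignment l) : TPAssignment l := fun _ _ _ _ P =>
  {z | ∀ h : ∀ i, IsNormFun (gauge (P i)), ν (fun i => Renormed (h i))
    ((PiTensorProduct.congr fun i => Renormed.equiv (h i)).symm z) ≤ 1}

theorem corresponds_bodyOf (hν : IsTensorNormFD ν) : Corresponds (bodyOf ν) ν := by
  intro E _ _ _ M _ _ _ P hP e he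
  change _ = PiTensorProduct.congr e '' _
  ext z
  rw [LinearEquiv.image_eq_preimage_symm, Set.mem_preimage, Set.mem_ofPred_eq]
  have h := fun i => (hP i).isNormFun_gauge
  have key : ν (fun i => Renormed (h i))
      ((PiTensorProduct.congr fun i => Renormed.equiv (h i)).symm z) =
      ν M ((PiTensorProduct.congr e).symm z) := by
    rw [← hν.map_isometry (fun i => (e i).trans (Renormed.equiv (h i)).symm)
      fun i x => (he i x).symm]
    congr 1
    rw [LinearEquiv.symm_apply_eq]
    have := congr_map_comm (fun i => (e i).trans (Renormed.equiv (h i)).symm) e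
      (fun i => LinearMap.id) (fun i => (Renormed.equiv (h i)).toLinearMap) (fun i x => rfl)
      ((PiTensorProduct.congr e).symm z)
    rw [PiTensorProduct.map_id, LinearMap.id_apply, LinearEquiv.apply_symm_apply] at this
    exact this.symm
  rw [← key]
  exact ⟨fun hz => hz h, fun hz _ => hz⟩

theorem Corresponds.isSymBody (hC : Corresponds A ν) (hν : IsTensorNormFD ν) (E : Fin l → Type)
    [∀ i, NormedAddCommGroup (E i)] [∀ i, InnerProductSpace ℝ (E i)]
    [∀ i, FiniteDimensional ℝ (E i)] (P : ∀ i, Set (E i)) (hP : ∀ i, IsSymBody (P i)) :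
    IsSymBody (A E P) := by
  have hn := hν.isNormFun fun i => Renormed (hP i).isNormFun_gauge
  let φ := PiTensorProduct.congr fun i => Renormed.equiv (hP i).isNormFun_gauge
  have : IsNormFun fun z => ν (fun i => Renormed (hP i).isNormFun_gauge) (φ.symm z) :=
    ⟨fun u v => by rw [map_add]; exact hn.add_le _ _,
      fun c u => by rw [_root_.map_smul]; exact hn.smul c _,
      fun u hu => φ.symm.map_eq_zero_iff.1 (hn.eq_zero _ hu)⟩
  convert this.isSymBody
  ext z
  exact hC.mem_iff hP (fun i => isModel_renormed (hP i)) z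

theorem Corresponds.projTP_subset (hC : Corresponds A ν) (hν : IsTensorNormFD ν)
    (E : Fin l → Type) [∀ i, NormedAddCommGroup (E i)] [∀ i, InnerProductSpace ℝ (E i)]
    [∀ i, FiniteDimensional ℝ (E i)] (P : ∀ i, Set (E i)) (hP : ∀ i, IsSymBody (P i)) :
    projTP E P ⊆ A E P := by
  refine convexHull_min ?_ (hC.isSymBody hν E P hP).1.2.1
  rintro _ ⟨x, hx, rfl⟩
  rw [hC.mem_iff hP (fun i => isModel_renormed (hP i)), PiTensorProduct.congr_symm_tprod]
  refine (hν.tprod_le _ _).trans (Finset.prod_le_one (fun i _ => norm_nonneg _) fun i _ => ?_)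
  exact ((hP i).gauge_le_one_iff _).2 (hx i)

theorem Corresponds.subset_injTP (hC : Corresponds A ν) (hν : IsTensorNormFD ν)
    (E : Fin l → Type) [∀ i, NormedAddCommGroup (E i)] [∀ i, InnerProductSpace ℝ (E i)]
    [∀ i, FiniteDimensional ℝ (E i)] (P : ∀ i, Set (E i)) (hP : ∀ i, IsSymBody (P i)) :
    A E P ⊆ injTP E P := by
  intro z hz
  have hle := (hC.mem_iff hP (fun i => isModel_renormed (hP i)) z).1 hz
  refine fun u hu => convexHull_min (t := {u | tensorInner E u z ≤ 1}) ?_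
    (convex_halfSpace_le ((tensorInner E).flip z).isLinear 1) hu
  rintro _ ⟨f, hf, rfl⟩
  let g : ∀ i, Renormed (hP i).isNormFun_gauge →L[ℝ] ℝ := fun i =>
    (innerₗ (E i) (f i) ∘ₗ (Renormed.equiv (hP i).isNormFun_gauge).toLinearMap).toContinuousLinearMap
  have hg : ∀ i, ‖g i‖ ≤ 1 := fun i => by
    refine ContinuousLinearMap.opNorm_le_bound _ zero_le_one fun x => ?_
    rw [one_mul]
    refine (isNormFun_norm (Renormed (hP i).isNormFun_gauge)).le_of_ball_subset (isNormFun_norm ℝ)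
      (g i : _ →ₗ[ℝ] ℝ) (fun y hy => ?_) x
    have hy := (isModel_renormed (hP i)).mem_iff (hP i) y |>.2 hy
    have h1 := hf i _ hy
    have h2 := hf i _ ((hP i).neg_mem hy)
    rw [innerₗ_comm, _root_.map_neg] at h2
    rw [innerₗ_comm] at h1
    exact abs_le.2 ⟨neg_le.1 h2, h1⟩
  have hkey : tensorInner E (⨂ₜ[ℝ] i, f i) ∘ₗ
      (PiTensorProduct.congr fun i => Renormed.equiv (hP i).isNormFun_gauge).toLinearMap =
      PiTensorProduct.lift ((MultilinearMap.mkPiAlgebra ℝ (Fin l) ℝ).compLinearMap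
        (fun i => (g i : _ →ₗ[ℝ] ℝ))) := by
    ext x
    simp [tensorInner_tprod, g]
  have := LinearMap.congr_fun hkey
    ((PiTensorProduct.congr fun i => Renormed.equiv (hP i).isNormFun_gauge).symm z)
  simp only [LinearMap.comp_apply, LinearEquiv.coe_coe, LinearEquiv.apply_symm_apply] at this
  rw [Set.mem_ofPred_eq, this]
  exact (le_abs_self _).trans ((le_injNorm _ _ g hg).trans (((hν.2.2.2.1 _ _).1).trans hle))

theorem Corresponds.isTPSym (hC : Corresponds A ν) (hν : IsTensorNormFD ν) : IsTPSym A := by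
  refine ⟨fun E _ _ _ P hP => ⟨hC.isSymBody hν E P hP, hC.projTP_subset hν E P hP,
    hC.subset_injTP hν E P hP⟩, ?_⟩
  intro E F _ _ _ _ _ _ P Q T hP hQ hT
  rintro _ ⟨z, hz, rfl⟩
  obtain ⟨u, rfl⟩ :=
    (PiTensorProduct.congr fun i => Renormed.equiv (hP i).isNormFun_gauge).surjective z
  rw [hC.congr_mem_iff hP fun i => isModel_renormed (hP i)] at hz
  let S : ∀ i, Renormed (hP i).isNormFun_gauge →ₗ[ℝ] Renormed (hQ i).isNormFun_gauge := fun i =>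
    (Renormed.equiv (hQ i).isNormFun_gauge).symm.toLinearMap ∘ₗ T i ∘ₗ
      (Renormed.equiv (hP i).isNormFun_gauge).toLinearMap
  rw [congr_map_comm _ (fun i => Renormed.equiv (hQ i).isNormFun_gauge) S T fun i x => rfl,
    hC.congr_mem_iff hQ fun i => isModel_renormed (hQ i)]
  refine (hν.map_le S (fun i => ?_) u).trans hz
  refine (isNormFun_norm _).le_of_ball_subset (isNormFun_norm _) (S i) fun x hx => ?_
  exact ((hQ i).gauge_le_one_iff _).2
    (hT i ⟨_, ((isModel_renormed (hP i)).mem_iff (hP i) x).2 hx, rfl⟩)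

end Corresponds

end Correspondence

section Transfer

theorem map_injective {E F : Fin l → Type} [∀ i, AddCommGroup (E i)] [∀ i, Module ℝ (E i)]
    [∀ i, AddCommGroup (F i)] [∀ i, Module ℝ (F i)] (T : ∀ i, E i →ₗ[ℝ] F i)
    (hT : ∀ i, Function.Injective (T i)) : Function.Injective (PiTensorProduct.map T) := by
  choose S hS using fun i => (T i).exists_leftInverse_of_injective (LinearMap.ker_eq_bot.2 (hT i))
  refine Function.LeftInverse.injective (g := PiTensorProduct.map S) fun u => ?_
  rw [← LinearMap.comp_apply, ← PiTensorProduct.map_comp]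
  simp [hS]

variable {A : TPAssignment l} {ν : TNAssignment l}

theorem IsInjectiveSym.map_subtype_mem_iff (hA : IsInjectiveSym A) {E : Fin l → Type}
    [∀ i, NormedAddCommGroup (E i)] [∀ i, InnerProductSpace ℝ (E i)]
    [∀ i, FiniteDimensional ℝ (E i)] {P : ∀ i, Set (E i)} (hP : ∀ i, IsSymBody (P i))
    (M : ∀ i, Submodule ℝ (E i)) (u : ⨂[ℝ] i, M i) :
    PiTensorProduct.map (fun i => (M i).subtype) u ∈ A E P ↔
      u ∈ A (fun i => M i) (fun i => Subtype.val ⁻¹' P i) := by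
  rw [← (map_injective (fun i => (M i).subtype) fun i => (M i).injective_subtype).mem_set_image,
    hA E P M hP]
  simp

theorem Corresponds.isInjectiveTN (hC : Corresponds A ν) (hν : IsTensorNormFD ν)
    (hA : IsInjectiveSym A) : IsInjectiveTN ν := by
  intro X _ _ _ S u
  have hP := fun i => stdEquiv_isSymBody (X i)
  refine le_antisymm ?_ (hν.map_le (fun i => (S i).subtype) (fun i x => le_rfl) u)
  refine le_one_of_forall_lt ((hν.isNormFun X).nonneg _) fun c hc hu => ?_
  rw [← abs_of_pos hc, ← hν.2.1] at hu ⊢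
  rw [← _root_.map_smul] at hu
  rw [← hC.congr_mem_iff hP fun i => isModel_image _, ← congr_map_comm
    (fun i => (stdEquiv (X i)).ofSubmodules (S i) _ rfl) _ _ (fun i => Submodule.subtype _)
    fun i x => rfl, hA.map_subtype_mem_iff hP] at hu
  exact (hC.congr_mem_iff
    (fun i => isSymBody_preimage (hP i) _ (Submodule.injective_subtype _))
    (fun i => (isModel_image _).submodule rfl) _).1 hu

theorem Corresponds.isInjectiveSym (hC : Corresponds A ν) (hν : IsInjectiveTN ν) :
    IsInjectiveSym A := by
  intro E _ _ _ P M hP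
  have key : ∀ v : ⨂[ℝ] i, M i, v ∈ A (fun i => M i) (fun i => Subtype.val ⁻¹' P i) ↔
      PiTensorProduct.map (fun i => (M i).subtype) v ∈ A E P := by
    intro v
    let e := fun i => Renormed.equiv (hP i).isNormFun_gauge
    have h : ∀ i, ((M i).comap (e i).toLinearMap).map (e i).toLinearMap = M i := fun i =>
      Submodule.map_comap_eq_of_surjective (e i).surjective _
    let f := fun i => (e i).ofSubmodules _ _ (h i)
    obtain ⟨u, rfl⟩ := (PiTensorProduct.congr f).surjective v
    have hM : ∀ i, IsSymBody (Subtype.val ⁻¹' P i : Set (M i)) := fun i =>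
      isSymBody_preimage (hP i) _ (Submodule.injective_subtype _)
    rw [hC.congr_mem_iff hM fun i => (isModel_renormed (hP i)).submodule (h i),
      congr_map_comm f e (fun i => Submodule.subtype _) _ fun i x => rfl,
      hC.congr_mem_iff hP fun i => isModel_renormed (hP i), hν]
  ext z
  constructor
  · rintro ⟨v, hv, rfl⟩
    exact ⟨(key v).1 hv, v, rfl⟩
  · rintro ⟨hv, v, rfl⟩
    exact ⟨v, (key v).2 hv, rfl⟩

theorem image_eq_iff_of_comm {X Y E F : Type*} (e : X ≃ E) (f : Y ≃ F) (T : X → Y) (S : E → F)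
    (h : ∀ x, S (e x) = f (T x)) (C : Set X) (D : Set Y) :
    S '' (e '' C) = f '' D ↔ T '' C = D := by
  rw [Set.image_image]
  simp only [h]
  rw [← Set.image_image f T, f.injective.image_injective.eq_iff]

theorem Corresponds.map_image_eq_iff (hC : Corresponds A ν) {E F X Y : Fin l → Type}
    [∀ i, NormedAddCommGroup (E i)] [∀ i, InnerProductSpace ℝ (E i)]
    [∀ i, FiniteDimensional ℝ (E i)] [∀ i, NormedAddCommGroup (F i)]
    [∀ i, InnerProductSpace ℝ (F i)] [∀ i, FiniteDimensional ℝ (F i)]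
    [∀ i, NormedAddCommGroup (X i)] [∀ i, NormedSpace ℝ (X i)] [∀ i, FiniteDimensional ℝ (X i)]
    [∀ i, NormedAddCommGroup (Y i)] [∀ i, NormedSpace ℝ (Y i)] [∀ i, FiniteDimensional ℝ (Y i)]
    {P : ∀ i, Set (E i)} {Q : ∀ i, Set (F i)} {e : ∀ i, X i ≃ₗ[ℝ] E i} {f : ∀ i, Y i ≃ₗ[ℝ] F i}
    (hP : ∀ i, IsSymBody (P i)) (he : ∀ i, IsModel (P i) (e i)) (hQ : ∀ i, IsSymBody (Q i))
    (hf : ∀ i, IsModel (Q i) (f i)) (T : ∀ i, X i →ₗ[ℝ] Y i) (S : ∀ i, E i →ₗ[ℝ] F i)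
    (h : ∀ i x, S i (e i x) = f i (T i x)) :
    PiTensorProduct.map S '' A E P = A F Q ↔
      PiTensorProduct.map T '' {u | ν X u ≤ 1} = {w | ν Y w ≤ 1} := by
  rw [hC.eq_image hP he, hC.eq_image hQ hf]
  exact image_eq_iff_of_comm (PiTensorProduct.congr e).toEquiv (PiTensorProduct.congr f).toEquiv
    _ _ (congr_map_comm e f T S h) _ _

theorem Corresponds.isProjectiveTN (hC : Corresponds A ν) (hν : IsTensorNormFD ν)
    (hA : IsProjectiveSym A) : IsProjectiveTN ν := by
  intro X Y _ _ _ _ _ _ T hT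
  have hP := fun i => stdEquiv_isSymBody (X i)
  have hQ := fun i => stdEquiv_isSymBody (Y i)
  let S := fun i =>
    (stdEquiv (Y i)).toLinearMap ∘ₗ (T i).toLinearMap ∘ₗ (stdEquiv (X i)).symm.toLinearMap
  have hS : ∀ i x, S i (stdEquiv (X i) x) = stdEquiv (Y i) (T i x) := fun i x => by simp [S]
  have hSP : ∀ i, S i '' (stdEquiv (X i) '' Metric.closedBall 0 1) =
      stdEquiv (Y i) '' Metric.closedBall 0 1 := fun i =>
    (image_eq_iff_of_comm (stdEquiv (X i)).toEquiv (stdEquiv (Y i)).toEquiv (T i) (S i) (hS i)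
      _ _).2 ((image_ball_eq_iff (T i).toLinearMap).1 (hT i))
  have hsurj : ∀ i, Function.Surjective (S i) := fun i => by
    rw [← LinearMap.range_eq_top]
    refine Submodule.eq_top_of_nonempty_interior' _ ((hQ i).1.2.2.mono (interior_mono ?_))
    rw [← hSP]
    exact Set.image_subset_range _ _
  have := hA _ _ _ S hP hsurj
  simp only [hSP] at this
  exact (((hν.isNormFun X).image_ball_eq_iff (hν.isNormFun Y) _).2 ((hC.map_image_eq_iff hP
    (fun i => isModel_image _) hQ (fun i => isModel_image _) _ S hS).1 this)).symm

theorem Corresponds.isProjectiveSym (hC : Corresponds A ν) (hν : IsTensorNormFD ν)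
    (hpr : IsProjectiveTN ν) : IsProjectiveSym A := by
  intro E F _ _ _ _ _ _ P T hP hT
  have hQ := fun i => isSymBody_image (hP i) (T i) (hT i)
  let e := fun i => Renormed.equiv (hP i).isNormFun_gauge
  let f := fun i => Renormed.equiv (hQ i).isNormFun_gauge
  let S := fun i => ((f i).symm.toLinearMap ∘ₗ T i ∘ₗ (e i).toLinearMap).toContinuousLinearMap
  have hS : ∀ i x, T i (e i x) = f i (S i x) := fun i x => by simp [S]
  have hball : ∀ i, S i '' Metric.ball 0 1 = Metric.ball 0 1 := fun i => by
    refine (image_ball_eq_iff (S i).toLinearMap).2 ((image_eq_iff_of_comm (e i).toEquiv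
      (f i).toEquiv (S i) (T i) (hS i) _ _).1 ?_)
    have h1 := (isModel_renormed (hP i)).image_closedBall (hP i)
    have h2 := (isModel_renormed (hQ i)).image_closedBall (hQ i)
    exact (congrArg (T i '' ·) h1).trans h2.symm
  exact (hC.map_image_eq_iff hP (fun i => isModel_renormed (hP i)) hQ
    (fun i => isModel_renormed (hQ i)) _ T hS).2
    (((hν.isNormFun _).image_ball_eq_iff (hν.isNormFun _) _).1 (hpr _ _ S hball).symm)

theorem leTN_of_leTPSym {B : TPAssignment l} {β : TNAssignment l} (hA : Corresponds A ν)
    (hν : IsTensorNormFD ν) (hB : Corresponds B β) (hβ : IsTensorNormFD β)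
    (h : leTPSym A B) : leTN β ν := by
  intro M _ _ _ z
  refine (hν.isNormFun M).le_of_ball_subset (hβ.isNormFun M) LinearMap.id (fun u hu => ?_) z
  have hP := fun i => stdEquiv_isSymBody (M i)
  have hm := fun i => isModel_image (stdEquiv (M i))
  exact (hB.congr_mem_iff hP hm u).1 (h _ _ hP ((hA.congr_mem_iff hP hm u).2 hu))

theorem leTPSym_of_leTN {B : TPAssignment l} {β : TNAssignment l} (hA : Corresponds A ν)
    (hB : Corresponds B β) (h : leTN β ν) : leTPSym A B := by
  intro E _ _ _ P hP z hz
  have hm := fun i => isModel_renormed (hP i)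
  exact (hB.mem_iff hP hm z).2 ((h _ _).trans ((hA.mem_iff hP hm z).1 hz))

end Transfer

section Duality

theorem polarB_innerₗ_isSymBody {H : Type*} [NormedAddCommGroup H] [InnerProductSpace ℝ H]
    [FiniteDimensional ℝ H] {P : Set H} (hP : IsSymBody P) : IsSymBody (polarB (innerₗ H) P) :=
  hP.polarB (innerₗ_nondegenerate H)

theorem polarB_polarB_innerₗ {H : Type*} [NormedAddCommGroup H] [InnerProductSpace ℝ H]
    [FiniteDimensional ℝ H] {P : Set H} (hP : IsSymBody P) :
    polarB (innerₗ H) (polarB (innerₗ H) P) = P :=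
  bipolar (innerₗ_comm H) (innerₗ_nondegenerate H) hP.1.2.1 hP.1.1.isClosed hP.zero_mem

theorem tensor_bipolar (E : Fin l → Type) [∀ i, NormedAddCommGroup (E i)]
    [∀ i, InnerProductSpace ℝ (E i)] [∀ i, FiniteDimensional ℝ (E i)] {C : Set (⨂[ℝ] i, E i)}
    (hconv : Convex ℝ C) (hcl : IsClosed C) (h0 : 0 ∈ C) :
    polarB (tensorInner E) (polarB (tensorInner E) C) = C :=
  bipolar (tensorInner_comm E) (tensorInner_nondegenerate E) hconv hcl h0

section Adjoint

variable {E F : Type*} [NormedAddCommGroup E] [InnerProductSpace ℝ E] [FiniteDimensional ℝ E]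
  [NormedAddCommGroup F] [InnerProductSpace ℝ F] [FiniteDimensional ℝ F]

theorem adjoint_surjective {S : F →ₗ[ℝ] E} (hS : Function.Injective S) :
    Function.Surjective S.adjoint := by
  obtain ⟨R, hR⟩ := S.exists_leftInverse_of_injective (LinearMap.ker_eq_bot.2 hS)
  refine Function.RightInverse.surjective (g := R.adjoint) fun x => ?_
  rw [← LinearMap.comp_apply, ← LinearMap.adjoint_comp, hR, LinearMap.adjoint_id,
    LinearMap.id_apply]

theorem adjoint_injective {T : E →ₗ[ℝ] F} (hT : Function.Surjective T) :
    Function.Injective T.adjoint := by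
  obtain ⟨R, hR⟩ := T.exists_rightInverse_of_surjective (LinearMap.range_eq_top.2 hT)
  refine Function.LeftInverse.injective (g := R.adjoint) fun x => ?_
  rw [← LinearMap.comp_apply, ← LinearMap.adjoint_comp, hR, LinearMap.adjoint_id,
    LinearMap.id_apply]

theorem polarB_innerₗ_image (T : E →ₗ[ℝ] F) (C : Set E) :
    polarB (innerₗ F) (T '' C) = T.adjoint ⁻¹' polarB (innerₗ E) C :=
  polarB_image _ _ T _ (fun u w => (LinearMap.adjoint_inner_right T u w).symm) C

theorem polarB_innerₗ_preimage {S : F →ₗ[ℝ] E} (hS : Function.Injective S) {P : Set E}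
    (hP : IsSymBody P) :
    polarB (innerₗ F) (S ⁻¹' P) = S.adjoint '' polarB (innerₗ E) P := by
  rw [← polarB_polarB_innerₗ
    (isSymBody_image (polarB_innerₗ_isSymBody hP) _ (adjoint_surjective hS)),
    polarB_innerₗ_image, LinearMap.adjoint_adjoint, polarB_polarB_innerₗ hP]

end Adjoint

theorem polarB_tensorInner_map_image {E F : Fin l → Type} [∀ i, NormedAddCommGroup (E i)]
    [∀ i, InnerProductSpace ℝ (E i)] [∀ i, FiniteDimensional ℝ (E i)]
    [∀ i, NormedAddCommGroup (F i)] [∀ i, InnerProductSpace ℝ (F i)]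
    [∀ i, FiniteDimensional ℝ (F i)] (T : ∀ i, E i →ₗ[ℝ] F i) (C : Set (⨂[ℝ] i, E i)) :
    polarB (tensorInner F) (PiTensorProduct.map T '' C) =
      PiTensorProduct.map (fun i => (T i).adjoint) ⁻¹' polarB (tensorInner E) C :=
  polarB_image _ _ _ _
    (tensorInner_map E F T _ fun i u w => (LinearMap.adjoint_inner_right (T i) u w).symm) C

variable {A : TPAssignment l}

theorem leTPSym.dualTP {B : TPAssignment l} (h : leTPSym A B) :
    leTPSym (dualTP B) (dualTP A) := fun E _ _ _ _ hP =>
  polarB_antitone _ (h E _ fun i => polarB_innerₗ_isSymBody (hP i))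

theorem IsTPSym.dualTP_dualTP (hA : IsTPSym A) : eqOnSymBodies (dualTP (dualTP A)) A := by
  intro E _ _ _ P hP
  have h := (hA.1 E P hP).1
  simp only [dualTP, fun i => polarB_polarB_innerₗ (hP i)]
  exact tensor_bipolar E h.1.2.1 h.1.1.isClosed h.zero_mem

theorem IsTPSym.dualTP (hA : IsTPSym A) : IsTPSym (dualTP A) := by
  refine ⟨fun E _ _ _ P hP => ?_, fun E F _ _ _ _ _ _ P Q T hP hQ hT => ?_⟩
  · have hP' := fun i => polarB_innerₗ_isSymBody (hP i)
    obtain ⟨h1, h2, h3⟩ := hA.1 E _ hP'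
    refine ⟨h1.polarB (tensorInner_nondegenerate E), ?_, polarB_antitone _ h2⟩
    refine (subset_polarB_polarB (tensorInner_comm E) _).trans (polarB_antitone _ ?_)
    simpa only [injTP, fun i => polarB_polarB_innerₗ (hP i)] using h3
  · have hT' : ∀ i, (T i).adjoint '' polarB (innerₗ (F i)) (Q i) ⊆ polarB (innerₗ (E i)) (P i) :=
      fun i => by
        rw [Set.image_subset_iff, ← polarB_innerₗ_image]
        exact polarB_antitone _ (hT i)
    have := hA.2 F E _ _ _ (fun i => polarB_innerₗ_isSymBody (hQ i))
      (fun i => polarB_innerₗ_isSymBody (hP i)) hT'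
    have := polarB_antitone (tensorInner E) this
    rw [polarB_tensorInner_map_image] at this
    simp only [LinearMap.adjoint_adjoint] at this
    exact Set.image_subset_iff.2 this

theorem IsProjectiveSym.isInjectiveSym_dualTP (hA : IsProjectiveSym A) :
    IsInjectiveSym (dualTP A) := by
  intro E _ _ _ P M hP
  have key : dualTP A (fun i => M i) (fun i => Subtype.val ⁻¹' P i) =
      PiTensorProduct.map (fun i => (M i).subtype) ⁻¹' dualTP A E P := by
    have h : ∀ i, polarB (innerₗ (M i)) (Subtype.val ⁻¹' P i) =
        (M i).subtype.adjoint '' polarB (innerₗ (E i)) (P i) := fun i =>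
      polarB_innerₗ_preimage (M i).injective_subtype (hP i)
    simp only [dualTP, h]
    rw [← hA _ _ _ _ (fun i => polarB_innerₗ_isSymBody (hP i))
      fun i => adjoint_surjective (M i).injective_subtype, polarB_tensorInner_map_image]
    simp only [LinearMap.adjoint_adjoint]
  rw [key, Set.image_preimage_eq_inter_range]

end Duality

section Hull

variable (A : TPAssignment l)

theorem leTPSym_injHullSym : leTPSym A (injHullSym A) :=
  fun E _ _ _ P hP => Set.subset_iInter₂ fun _ hB => hB.2.2 E P hP

theorem injHullSym_leTPSym {B : TPAssignment l} (hB : IsTPSym B) (hinj : IsInjectiveSym B)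
    (hle : leTPSym A B) : leTPSym (injHullSym A) B :=
  fun _ _ _ _ _ _ => Set.biInter_subset_of_mem ⟨hB, hinj, hle⟩

theorem map_mem_injHullSym {E F : Fin l → Type} [∀ i, NormedAddCommGroup (E i)]
    [∀ i, InnerProductSpace ℝ (E i)] [∀ i, FiniteDimensional ℝ (E i)]
    [∀ i, NormedAddCommGroup (F i)] [∀ i, InnerProductSpace ℝ (F i)]
    [∀ i, FiniteDimensional ℝ (F i)] {P : ∀ i, Set (E i)} {Q : ∀ i, Set (F i)}
    (T : ∀ i, E i →ₗ[ℝ] F i) (hP : ∀ i, IsSymBody (P i)) (hQ : ∀ i, IsSymBody (Q i))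
    (hT : ∀ i, T i '' P i ⊆ Q i) {z : ⨂[ℝ] i, E i} (hz : z ∈ injHullSym A E P) :
    PiTensorProduct.map T z ∈ injHullSym A F Q :=
  Set.mem_iInter₂.2 fun B hB => hB.1.2 E F P Q T hP hQ hT ⟨z, Set.mem_iInter₂.1 hz B hB, rfl⟩

theorem isInjectiveSym_injHullSym : IsInjectiveSym (injHullSym A) := by
  intro E _ _ _ P M hP
  ext z
  constructor
  · rintro ⟨v, hv, rfl⟩
    exact ⟨Set.mem_iInter₂.2 fun B hB =>
      (hB.2.1.map_subtype_mem_iff hP M v).2 (Set.mem_iInter₂.1 hv B hB), v, rfl⟩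
  · rintro ⟨hv, v, rfl⟩
    exact ⟨v, Set.mem_iInter₂.2 fun B hB =>
      (hB.2.1.map_subtype_mem_iff hP M v).1 (Set.mem_iInter₂.1 hv B hB), rfl⟩

theorem map_mem_injHullSym_iff {E F : Fin l → Type} [∀ i, NormedAddCommGroup (E i)]
    [∀ i, InnerProductSpace ℝ (E i)] [∀ i, FiniteDimensional ℝ (E i)]
    [∀ i, NormedAddCommGroup (F i)] [∀ i, InnerProductSpace ℝ (F i)]
    [∀ i, FiniteDimensional ℝ (F i)] {P : ∀ i, Set (E i)} (hP : ∀ i, IsSymBody (P i))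
    (S : ∀ i, F i →ₗ[ℝ] E i) (hS : ∀ i, Function.Injective (S i)) (z : ⨂[ℝ] i, F i) :
    PiTensorProduct.map S z ∈ injHullSym A E P ↔ z ∈ injHullSym A F fun i => S i ⁻¹' P i := by
  have hQ := fun i => isSymBody_preimage (hP i) (S i) (hS i)
  refine ⟨fun h => ?_, map_mem_injHullSym A S hQ hP fun i => Set.image_preimage_subset _ _⟩
  let φ := fun i => LinearEquiv.ofInjective (S i) (hS i)
  have hcomp : PiTensorProduct.map S z = PiTensorProduct.map
      (fun i => (LinearMap.range (S i)).subtype) (PiTensorProduct.congr φ z) := by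
    have := congr_map_comm φ (fun i => LinearEquiv.refl ℝ (E i)) S
      (fun i => (LinearMap.range (S i)).subtype) (fun i x => rfl) z
    rw [this]
    exact (LinearMap.congr_fun PiTensorProduct.map_id _).symm
  rw [hcomp, (isInjectiveSym_injHullSym A).map_subtype_mem_iff hP] at h
  have := map_mem_injHullSym A (fun i => ((φ i).symm : _ →ₗ[ℝ] F i))
    (fun i => isSymBody_preimage (hP i) _ (Submodule.injective_subtype _)) hQ (fun i => ?_) h
  · rwa [show PiTensorProduct.map (fun i => ((φ i).symm : _ →ₗ[ℝ] F i))
      (PiTensorProduct.congr φ z) = z from (PiTensorProduct.congr φ).symm_apply_apply z] at this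
  · rintro _ ⟨y, hy, rfl⟩
    obtain ⟨x, rfl⟩ := (φ i).surjective y
    simpa [φ] using hy

theorem isProjectiveSym_dualTP_injHullSym {E F : Fin l → Type} [∀ i, NormedAddCommGroup (E i)]
    [∀ i, InnerProductSpace ℝ (E i)] [∀ i, FiniteDimensional ℝ (E i)]
    [∀ i, NormedAddCommGroup (F i)] [∀ i, InnerProductSpace ℝ (F i)]
    [∀ i, FiniteDimensional ℝ (F i)] {P : ∀ i, Set (E i)} (hP : ∀ i, IsSymBody (P i))
    (hsym : IsSymBody (dualTP (injHullSym A) E P)) (T : ∀ i, E i →ₗ[ℝ] F i)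
    (hT : ∀ i, Function.Surjective (T i)) :
    PiTensorProduct.map T '' dualTP (injHullSym A) E P =
      dualTP (injHullSym A) F fun i => T i '' P i := by
  have hP' := fun i => polarB_innerₗ_isSymBody (hP i)
  have hbi : polarB (tensorInner E) (dualTP (injHullSym A) E P) =
      injHullSym A E fun i => polarB (innerₗ (E i)) (P i) :=
    tensor_bipolar E
      (convex_iInter₂ fun B hB => (hB.1.1 E _ hP').1.1.2.1)
      (isClosed_biInter fun B hB => (hB.1.1 E _ hP').1.1.1.isClosed)
      (Set.mem_iInter₂.2 fun B hB => (hB.1.1 E _ hP').1.zero_mem)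
  have hfin : Continuous (PiTensorProduct.map T) :=
    LinearMap.continuous_of_finiteDimensional _
  rw [← tensor_bipolar F (hsym.1.2.1.linear_image (PiTensorProduct.map T))
    (hsym.1.1.image hfin).isClosed ⟨0, hsym.zero_mem, _root_.map_zero _⟩,
    polarB_tensorInner_map_image, hbi]
  unfold dualTP
  congr 1
  ext z
  rw [Set.mem_preimage, map_mem_injHullSym_iff A hP' _ fun i => adjoint_injective (hT i)]
  simp only [polarB_innerₗ_image]

end Hull

end

/-- **Hulls correspond to associates.** If the tensor product of `0`-symmetric convex
bodies `⊗_α` corresponds to the tensor norm `ν = ‖·‖_{⊗_α}`, then the tensor norm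
corresponding to `⊗_{α^{inj}}` is the injective associate of `ν` (the biggest
injective tensor norm `≤ ν`), and the tensor norm corresponding to `⊗_{α^{proj}}` is
the projective associate of `ν` (the smallest projective tensor norm `≥ ν`). -/
theorem hulls_correspond_to_associates {l : ℕ} (A : TPAssignment l) (ν : TNAssignment l)
    (hA : IsTPSym A) (hν : IsTensorNormFD ν) (hCorr : Corresponds A ν) :
    (∀ νinj : TNAssignment l, IsTensorNormFD νinj → Corresponds (injHullSym A) νinj →
      IsInjectiveTN νinj ∧ leTN νinj ν ∧
      ∀ β : TNAssignment l, IsTensorNormFD β → IsInjectiveTN β → leTN β ν →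
        leTN β νinj) ∧
    (∀ νproj : TNAssignment l, IsTensorNormFD νproj → Corresponds (projHullSym A) νproj →
      IsProjectiveTN νproj ∧ leTN ν νproj ∧
      ∀ β : TNAssignment l, IsTensorNormFD β → IsProjectiveTN β → leTN ν β →
        leTN νproj β) := by
  refine ⟨fun νinj hνinj hCinj => ⟨?_, ?_, fun β hβ hβinj hle => ?_⟩,
    fun νproj hνproj hCproj => ⟨?_, ?_, fun β hβ hβproj hle => ?_⟩⟩
  · exact hCinj.isInjectiveTN hνinj (isInjectiveSym_injHullSym A)
  · exact leTN_of_leTPSym hCorr hν hCinj hνinj (leTPSym_injHullSym A)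
  · have hB := corresponds_bodyOf hβ
    exact leTN_of_leTPSym hCinj hνinj hB hβ (injHullSym_leTPSym A (hB.isTPSym hβ)
      (hB.isInjectiveSym hβinj) (leTPSym_of_leTN hCorr hB hle))
  · refine hCproj.isProjectiveTN hνproj fun E F _ _ _ _ _ _ P T hP hT => ?_
    exact isProjectiveSym_dualTP_injHullSym (dualTP A) hP (hCproj.isSymBody hνproj E P hP) T hT
  · refine leTN_of_leTPSym hCproj hνproj hCorr hν fun E _ _ _ P hP => ?_
    rw [← hA.dualTP_dualTP E P hP]
    exact (leTPSym_injHullSym (dualTP A)).dualTP E P hP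
  · have hB := corresponds_bodyOf hβ
    have hBT := hB.isTPSym hβ
    refine leTN_of_leTPSym hB hβ hCproj hνproj fun E _ _ _ P hP => ?_
    rw [← hBT.dualTP_dualTP E P hP]
    exact (injHullSym_leTPSym (dualTP A) hBT.dualTP
      (hB.isProjectiveSym hβ hβproj).isInjectiveSym_dualTP
      (leTPSym_of_leTN hB hCorr hle).dualTP).dualTP E P hP
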